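/- arXiv:2003.11333 — 2 statements merged into one kernel-verified Lean document; each statement's English description precedes it below -/
import Mathlib

section
/- Let θ ≥ 0, γ > 0, and real numbers v_i ≤ w_i and v_k ≤ w_k with w_i − v_i ≤ θ and w_k − v_k ≤ θ. If the one-dimensional longest-distance-based similarity value ŝ = min(1 − f(w_k − v_i, γ), 1 − f(w_i − v_k, γ)) satisfies ŝ < 1 − θ·γ, then max(w_i, w_k) − min(v_i, v_k) > θ. -/
/-- The ramp function `f(z, γ) = max(0, min(1, z·γ))`. -/
noncomputable def ramp (z γ : ℝ) : ℝ := max 0 (min 1 (z * γ))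

/-- If the ramp value at `z` exceeds `θ * γ`, then `z` exceeds `θ`. -/
theorem lt_of_mul_lt_ramp {θ γ z : ℝ} (hθ : 0 ≤ θ) (hγ : 0 < γ) (h : θ * γ < ramp z γ) :
    θ < z := by
  rcases lt_max_iff.mp h with h | h
  · exact absurd h (mul_nonneg hθ hγ.le).not_gt
  · exact lt_of_mul_lt_mul_right (lt_min_iff.mp h).2 hγ.le

theorem stmt_14 (θ γ vi wi vk wk : ℝ) (hθ : 0 ≤ θ) (hγ : 0 < γ)
    (hi : vi ≤ wi) (hk : vk ≤ wk)
    (hsizei : wi - vi ≤ θ) (hsizek : wk - vk ≤ θ)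
    (hs : min (1 - ramp (wk - vi) γ) (1 - ramp (wi - vk) γ) < 1 - θ * γ) :
    max wi wk - min vi vk > θ := by
  rcases min_lt_iff.mp hs with h | h
  · exact (lt_of_mul_lt_ramp hθ hγ (sub_lt_sub_iff_left 1 |>.mp h)).trans_le
      (sub_le_sub (le_max_right _ _) (min_le_left _ _))
  · exact (lt_of_mul_lt_ramp hθ hγ (sub_lt_sub_iff_left 1 |>.mp h)).trans_le
      (sub_le_sub (le_max_left _ _) (min_le_right _ _))
end

section
/- (Contrapositive hyperbox selection rule.) Let n ≥ 1, θ ≥ 0, and positive reals γ_1, …, γ_n with γ_max = max_{j=1..n} γ_j. Let h be a hyperbox with bounds v_j ≤ w_j, and let X be an input hyperbox with bounds x^l_j ≤ x^u_j and x^u_j − x^l_j ≤ θ for all j. If the hyperbox obtained by expanding h to cover X satisfies the maximum hyperbox size condition, i.e., max(w_j, x^u_j) − min(v_j, x^l_j) ≤ θ for all j, then the membership value satisfies b_h(X) = min_{j=1..n} min(1 − f(x^u_j − w_j, γ_j), 1 − f(v_j − x^l_j, γ_j)) ≥ 1 − θ·γ_max. -/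
theorem ramp_le_mul {z γ θ γ' : ℝ} (hθ : 0 ≤ θ) (hγ : 0 ≤ γ) (hz : z ≤ θ) (hγ' : γ ≤ γ') :
    ramp z γ ≤ θ * γ' :=
  max_le (mul_nonneg hθ (hγ.trans hγ'))
    ((min_le_right _ _).trans (mul_le_mul hz hγ' hγ hθ))

theorem stmt_18 (n : ℕ) (hn : 1 ≤ n) (θ : ℝ) (hθ : 0 ≤ θ)
    (γ : Fin n → ℝ) (hγ : ∀ j, 0 < γ j)
    (v w xl xu : Fin n → ℝ)
    (hvw : ∀ j, v j ≤ w j) (hx : ∀ j, xl j ≤ xu j)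
    (hsize : ∀ j, xu j - xl j ≤ θ)
    (hexp : ∀ j, max (w j) (xu j) - min (v j) (xl j) ≤ θ) :
    Finset.univ.inf' (Finset.univ_nonempty_iff.2 ⟨⟨0, hn⟩⟩)
        (fun j => min (1 - ramp (xu j - w j) (γ j)) (1 - ramp (v j - xl j) (γ j)))
      ≥ 1 - θ * Finset.univ.sup' (Finset.univ_nonempty_iff.2 ⟨⟨0, hn⟩⟩) γ := by
  refine Finset.le_inf' _ _ fun j _ => ?_
  have hγj : γ j ≤ Finset.univ.sup' (Finset.univ_nonempty_iff.2 ⟨⟨0, hn⟩⟩) γ :=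
    Finset.le_sup' γ (Finset.mem_univ j)
  have hu := le_max_right (w j) (xu j)
  have hw := le_max_left (w j) (xu j)
  have hv := min_le_left (v j) (xl j)
  have hl := min_le_right (v j) (xl j)
  have hupper : xu j - w j ≤ θ := by linarith [hexp j, hvw j]
  have hlower : v j - xl j ≤ θ := by linarith [hexp j, hvw j]
  exact le_min (sub_le_sub_left (ramp_le_mul hθ (hγ j).le hupper hγj) 1)
    (sub_le_sub_left (ramp_le_mul hθ (hγ j).le hlower hγj) 1)
end
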